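/- arXiv:math/0401011 — 2 statements merged into one kernel-verified Lean document; each statement's English description precedes it below -/
import Mathlib

section
/- Let φ : 𝒵 → ℝ satisfy: φ(constant D) = 1; φ is positive definite with respect to ∨ (for every n, all Z₁, …, Zₙ ∈ 𝒵 and c₁, …, cₙ ∈ ℝ, Σ_{i,j} c_i c_j φ(Z_i ∨ Z_j) ≥ 0); and φ is continuous from below (for every Z ∈ 𝒵, φ(Z_{-ε}) → φ(Z) as ε ↓ 0). Then there exists a unique Borel probability measure μ on 𝒴̃ such that φ(Z) = μ(Q̃_Z) for all Z ∈ 𝒵. -/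
open Set NNReal ENNReal

/-- A "partial order" on `M`: a reflexive and transitive (not necessarily
antisymmetric) relation, identified with a subset of `M × M`. -/
def IsPO {M : Type*} (V : Set (M × M)) : Prop :=
  (∀ j : M, (j, j) ∈ V) ∧ ∀ j k l : M, (j, k) ∈ V → (k, l) ∈ V → (j, l) ∈ V

/-- The diagonal relation `D`. -/
def diagRel (M : Type*) : Set (M × M) := {p : M × M | p.1 = p.2}

/-- The smallest partial order containing `S` (reflexive-transitive closure). -/
def poGen {M : Type*} (S : Set (M × M)) : Set (M × M) :=
  ⋂₀ {V : Set (M × M) | IsPO V ∧ S ⊆ V}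

/-- The join of two partial orders: the smallest partial order containing their union. -/
def poJoin {M : Type*} (V W : Set (M × M)) : Set (M × M) := poGen (V ∪ W)

/-- Membership in `𝒴`: maps `Y : [0,∞) → {partial orders on M}` with `Y 0 = D`,
increasing, and left-continuous. -/
def MemY {M : Type*} (Y : ℝ≥0 → Set (M × M)) : Prop :=
  (∀ t : ℝ≥0, IsPO (Y t)) ∧ Y 0 = diagRel M ∧
    (∀ s t : ℝ≥0, s ≤ t → Y s ⊆ Y t) ∧
    ∀ t : ℝ≥0, 0 < t → Y t = ⋃ s ∈ Set.Iio t, Y s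

/-- The pointwise join on `𝒴`. -/
def joinY {M : Type*} (Y Z : ℝ≥0 → Set (M × M)) : ℝ≥0 → Set (M × M) :=
  fun t => poJoin (Y t) (Z t)

/-- The support of a partial order `V`. -/
def suppV {M : Type*} (V : Set (M × M)) : Set M :=
  {j : M | ∃ k : M, k ≠ j ∧ ((j, k) ∈ V ∨ (k, j) ∈ V)}

/-- The support of an order process `Y ∈ 𝒴`. -/
def suppY {M : Type*} (Y : ℝ≥0 → Set (M × M)) : Set M := ⋃ t : ℝ≥0, suppV (Y t)

/-- Membership in `𝒵`: elements of `𝒴` with finite support. -/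
def MemZ {M : Type*} (Y : ℝ≥0 → Set (M × M)) : Prop := MemY Y ∧ (suppY Y).Finite

/-- The delayed process `Z₋ε` (`ℝ≥0` has truncated subtraction, so
`Z₋ε t = Z (t - ε)` equals `Z 0 = D` for `t ≤ ε`). -/
def shiftY {M : Type*} (Z : ℝ≥0 → Set (M × M)) (ε : ℝ≥0) : ℝ≥0 → Set (M × M) :=
  fun t => Z (t - ε)

/-- The switching-time function `f_Y` with values in `[0,∞]` (`inf ∅ = ∞`). -/
noncomputable def fY {M : Type*} (Y : ℝ≥0 → Set (M × M)) (p : M × M) : ℝ≥0∞ :=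
  ⨅ (s : ℝ≥0) (_ : p ∈ Y s), (s : ℝ≥0∞)

/-- The off-diagonal pairs `(M × M) ∖ D`. -/
abbrev OffDiag (M : Type*) : Type _ := {p : M × M // p.1 ≠ p.2}

/-- The set `𝒴̃` of ultrametric-type functions on off-diagonal pairs. -/
def tildeY (M : Type*) : Set (OffDiag M → ℝ≥0∞) :=
  {f | ∀ (j k l : M) (hjk : j ≠ k) (hkl : k ≠ l) (hjl : j ≠ l),
    f ⟨(j, l), hjl⟩ ≤ max (f ⟨(j, k), hjk⟩) (f ⟨(k, l), hkl⟩)}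

/-- The switching-time function restricted to off-diagonal pairs. -/
noncomputable def fYo {M : Type*} (Y : ℝ≥0 → Set (M × M)) : OffDiag M → ℝ≥0∞ :=
  fun p => fY Y p.1

/-- `Q̃_Z`, as a subset of `𝒴̃`. -/
def Qtilde {M : Type*} (Z : ℝ≥0 → Set (M × M)) : Set (tildeY M) :=
  {f : tildeY M | ∀ p : OffDiag M, f.1 p ≤ fYo Z p}

/-- Positive definiteness with respect to `∨` of a function on `𝒵`. -/
def PosDefZ {M : Type*} (φ : (ℝ≥0 → Set (M × M)) → ℝ) : Prop :=
  ∀ (n : ℕ) (Z : Fin n → ℝ≥0 → Set (M × M)), (∀ i, MemZ (Z i)) →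
    ∀ c : Fin n → ℝ, 0 ≤ ∑ i, ∑ j, c i * c j * φ (joinY (Z i) (Z j))

/-- Continuity from below of a function on `𝒵`: `φ(Z₋ε) → φ(Z)` as `ε ↓ 0`. -/
def ContFromBelow {M : Type*} (φ : (ℝ≥0 → Set (M × M)) → ℝ) : Prop :=
  ∀ Z : ℝ≥0 → Set (M × M), MemZ Z →
    Filter.Tendsto (fun ε : ℝ≥0 => φ (shiftY Z ε)) (nhdsWithin 0 (Set.Ioi 0)) (nhds (φ Z))

open MeasureTheory

/-- positive definiteness of a function on finite subsets w.r.t. union -/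
def PDF {ι : Type*} [DecidableEq ι] (ψ : Finset ι → ℝ) : Prop :=
  ∀ (κ : Type) [Fintype κ] (B : κ → Finset ι) (c : κ → ℝ),
    0 ≤ ∑ i, ∑ j, c i * c j * ψ (B i ∪ B j)

theorem PDF.nonneg {ι : Type*} [DecidableEq ι] {ψ : Finset ι → ℝ} (h : PDF ψ) (B : Finset ι) :
    0 ≤ ψ B := by
  simpa using h Unit (fun _ => B) (fun _ => 1)

theorem PDF.one {ι : Type*} [DecidableEq ι] {ψ : Finset ι → ℝ} (h : PDF ψ) (a : ι) :
    PDF (fun B => ψ (insert a B)) := by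
  intro κ _ B c
  have := h κ (fun i => insert a (B i)) c
  refine this.trans_eq (Finset.sum_congr rfl fun i _ => Finset.sum_congr rfl fun j _ => ?_)
  simp only [Finset.insert_union, Finset.union_insert, Finset.insert_idem]

theorem PDF.zero {ι : Type*} [DecidableEq ι] {ψ : Finset ι → ℝ} (h : PDF ψ) (a : ι) :
    PDF (fun B => ψ B - ψ (insert a B)) := by
  intro κ _ B c
  have := h (κ ⊕ κ) (Sum.elim B (fun i => insert a (B i))) (Sum.elim c (fun i => - c i))
  simp only [Fintype.sum_sum_type, Sum.elim_inl, Sum.elim_inr, Finset.insert_union,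
    Finset.union_insert, Finset.insert_idem] at this
  refine this.trans_eq ?_
  rw [← Finset.sum_add_distrib]
  refine Finset.sum_congr rfl fun i _ => ?_
  rw [← Finset.sum_add_distrib, ← Finset.sum_add_distrib, ← Finset.sum_add_distrib]
  refine Finset.sum_congr rfl fun j _ => ?_
  ring

/-- cylinder -/
def cyl {ι : Type*} (B : Finset ι) : Set (ι → Bool) := {ω | ∀ i ∈ B, ω i = true}

theorem cyl_eq {ι : Type*} (B : Finset ι) :
    cyl B = ⋂ i ∈ B, (fun ω : ι → Bool => ω i) ⁻¹' {true} := by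
  ext; simp [cyl]

theorem measurableSet_cyl {ι : Type*} (B : Finset ι) : MeasurableSet (cyl B) := by
  rw [cyl_eq]
  exact Finset.measurableSet_biInter _ fun i _ =>
    (measurable_pi_apply i) (MeasurableSet.singleton _)

theorem isClopen_cyl {ι : Type*} (B : Finset ι) : IsClopen (cyl B) := by
  rw [cyl_eq]
  exact isClopen_biInter_finset fun i _ =>
    (isClopen_discrete {true}).preimage (continuous_apply i)

theorem exists_fin_measure {ι : Type*} [DecidableEq ι] (F : Finset ι) :
    ∀ ψ : Finset ι → ℝ, PDF ψ → ∃ μ : Measure (ι → Bool),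
      ∀ B ⊆ F, μ (cyl B) = ENNReal.ofReal (ψ B) := by
  induction F using Finset.induction_on with
  | empty =>
    intro ψ hψ
    refine ⟨ENNReal.ofReal (ψ ∅) • Measure.dirac (fun _ => true), ?_⟩
    intro B hB
    obtain rfl := Finset.subset_empty.1 hB
    simp [cyl]
  | insert a F ha ih =>
    intro ψ hψ
    obtain ⟨μ1, h1⟩ := ih _ (hψ.one a)
    obtain ⟨μ0, h0⟩ := ih _ (hψ.zero a)
    have hm : ∀ b : Bool, Measurable (fun ω : ι → Bool => Function.update ω a b) := by
      intro b
      exact measurable_update_left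
    refine ⟨μ1.map (fun ω => Function.update ω a true) +
      μ0.map (fun ω => Function.update ω a false), ?_⟩
    intro B hB
    rw [Measure.add_apply, Measure.map_apply (hm _) (measurableSet_cyl B),
      Measure.map_apply (hm _) (measurableSet_cyl B)]
    have e1 : (fun ω : ι → Bool => Function.update ω a true) ⁻¹' cyl B = cyl (B.erase a) := by
      ext ω
      simp only [cyl, Set.mem_preimage, Set.mem_ofPred_eq, Finset.mem_erase]
      refine forall_congr' fun i => ?_
      by_cases hi : i = a
      · subst hi; simp
      · simp [hi]
    have hsub : B.erase a ⊆ F := by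
      intro i hi
      have := hB (Finset.mem_of_mem_erase hi)
      exact (Finset.mem_insert.1 this).resolve_left (Finset.ne_of_mem_erase hi)
    rw [e1, h1 _ hsub]
    by_cases haB : a ∈ B
    · have e0 : (fun ω : ι → Bool => Function.update ω a false) ⁻¹' cyl B = ∅ := by
        ext ω
        simp only [cyl, Set.mem_preimage, Set.mem_ofPred_eq, Set.mem_empty_iff_false, iff_false]
        intro h
        simpa using h a haB
      rw [e0, Finset.insert_erase haB]; simp
    · have e0 : (fun ω : ι → Bool => Function.update ω a false) ⁻¹' cyl B = cyl B := by
        ext ω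
        simp only [cyl, Set.mem_preimage, Set.mem_ofPred_eq]
        refine forall_congr' fun i => ?_
        by_cases hi : i = a
        · subst hi; simp [haB]
        · simp [hi]
      rw [Finset.erase_eq_of_notMem haB] at hsub ⊢
      rw [e0, h0 _ hsub, ← ENNReal.ofReal_add ((hψ.one a).nonneg B) ((hψ.zero a).nonneg B)]
      congr 1; ring

theorem exists_cube_measure {ι : Type*} [Countable ι] [DecidableEq ι] (ψ : Finset ι → ℝ)
    (hψ : PDF ψ) (h1 : ψ ∅ = 1) : ∃ μ : Measure (ι → Bool), IsProbabilityMeasure μ ∧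
      ∀ B, μ (cyl B) = ENNReal.ofReal (ψ B) := by
  choose P hP using fun F : Finset ι => exists_fin_measure F ψ hψ
  have hprob : ∀ F, IsProbabilityMeasure (P F) := by
    intro F
    constructor
    have := hP F ∅ (by simp)
    simpa [cyl, h1] using this
  let Q : Finset ι → ProbabilityMeasure (ι → Bool) := fun F => ⟨P F, hprob F⟩
  let U : Ultrafilter (Finset ι) := Ultrafilter.of Filter.atTop
  obtain ⟨μ, -, hμ⟩ := isCompact_univ.ultrafilter_le_nhds (U.map Q) (by simp)
  have hμ' : Filter.Tendsto Q U (nhds μ) := hμ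
  refine ⟨μ, inferInstance, fun B => ?_⟩
  have t := ProbabilityMeasure.tendsto_measure_of_isClopen_of_tendsto hμ' (isClopen_cyl B)
  have ev : ∀ᶠ F in (U : Filter (Finset ι)), (Q F : Measure (ι → Bool)) (cyl B)
      = ENNReal.ofReal (ψ B) := by
    have : ∀ᶠ F in (Filter.atTop : Filter (Finset ι)), B ⊆ F := Filter.eventually_ge_atTop B
    have := this.filter_mono (Ultrafilter.of_le (Filter.atTop : Filter (Finset ι)))
    filter_upwards [this] with F hF
    exact hP F B hF
  have t2 : Filter.Tendsto (fun F => (Q F : Measure (ι → Bool)) (cyl B)) U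
     (nhds (ENNReal.ofReal (ψ B))) := by
    refine Filter.Tendsto.congr' ?_ tendsto_const_nhds
    filter_upwards [ev] with F hF using hF.symm
  have t' : Filter.Tendsto (fun F => (Q F : Measure (ι → Bool)) (cyl B)) U
     (nhds ((μ : Measure (ι → Bool)) (cyl B))) := by
    have := (ENNReal.continuous_coe.tendsto _).comp t
    simpa [Function.comp_def] using this
  exact tendsto_nhds_unique t' t2

section GenSec
variable {M : Type*}

theorem isPO_poGen (S : Set (M × M)) : IsPO (poGen S) := by
  constructor
  · intro j V hV
    exact hV.1.1 j
  · intro j k l h1 h2 V hV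
    exact hV.1.2 j k l (h1 V hV) (h2 V hV)

theorem subset_poGen (S : Set (M × M)) : S ⊆ poGen S :=
  fun _ hp _ hV => hV.2 hp

theorem poGen_min {S V : Set (M × M)} (hV : IsPO V) (h : S ⊆ V) : poGen S ⊆ V :=
  fun _ hp => hp V ⟨hV, h⟩

theorem poGen_mono {S T : Set (M × M)} (h : S ⊆ T) : poGen S ⊆ poGen T :=
  poGen_min (isPO_poGen T) (h.trans (subset_poGen T))

theorem isPO_diag : IsPO (diagRel M) :=
  ⟨fun _ => rfl, fun _ _ _ h1 h2 => Eq.trans (show _ = _ from h1) h2⟩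

/-- generators active at time `t` -/
def act (S : Set (OffDiag M × ℝ≥0)) (t : ℝ≥0) : Set (M × M) :=
  {p | ∃ x ∈ S, x.1.1 = p ∧ x.2 < t}

/-- order process generated by a set of timed pairs -/
def gen (S : Set (OffDiag M × ℝ≥0)) : ℝ≥0 → Set (M × M) := fun t => poGen (act S t)

theorem act_mono_t (S : Set (OffDiag M × ℝ≥0)) {s t : ℝ≥0} (h : s ≤ t) : act S s ⊆ act S t :=
  fun _ ⟨x, hx, hp, hl⟩ => ⟨x, hx, hp, hl.trans_le h⟩

theorem memY_gen (S : Set (OffDiag M × ℝ≥0)) : MemY (gen S) := by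
  have hmono : ∀ s t : ℝ≥0, s ≤ t → gen S s ⊆ gen S t :=
    fun s t h => poGen_mono (act_mono_t S h)
  refine ⟨fun t => isPO_poGen _, ?_, hmono, ?_⟩
  · apply Set.Subset.antisymm
    · refine poGen_min isPO_diag ?_
      rintro p ⟨x, _, _, h⟩
      exact absurd h (by simp)
    · rintro ⟨j, k⟩ h
      obtain rfl : j = k := h
      exact (isPO_poGen _).1 j
  · intro t ht
    apply Set.Subset.antisymm
    · refine poGen_min ⟨?_, ?_⟩ ?_
      · intro j
        simp only [Set.mem_iUnion]
        exact ⟨0, ht, (isPO_poGen _).1 j⟩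
      · intro j k l h1 h2
        simp only [Set.mem_iUnion] at h1 h2 ⊢
        obtain ⟨s1, hs1, h1⟩ := h1
        obtain ⟨s2, hs2, h2⟩ := h2
        exact ⟨max s1 s2, Set.mem_Iio.2 (max_lt hs1 hs2), (isPO_poGen _).2 j k l
          (hmono _ _ (le_max_left _ _) h1) (hmono _ _ (le_max_right _ _) h2)⟩
      · rintro p ⟨x, hx, hp, hl⟩
        obtain ⟨s, h1, h2⟩ := exists_between hl
        simp only [Set.mem_iUnion]
        exact ⟨s, h2, subset_poGen _ ⟨x, hx, hp, h1⟩⟩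
    · intro p hp
      simp only [Set.mem_iUnion] at hp
      obtain ⟨s, hs, hp⟩ := hp
      exact hmono _ _ (le_of_lt hs) hp

theorem memZ_gen {S : Set (OffDiag M × ℝ≥0)} (hS : S.Finite) : MemZ (gen S) := by
  refine ⟨memY_gen S, ?_⟩
  let A : Set M := (fun x : OffDiag M × ℝ≥0 => x.1.1.1) '' S ∪
    (fun x : OffDiag M × ℝ≥0 => x.1.1.2) '' S
  have hA : A.Finite := (hS.image _).union (hS.image _)
  refine hA.subset ?_
  have key : ∀ t, gen S t ⊆ {p | p.1 = p.2 ∨ (p.1 ∈ A ∧ p.2 ∈ A)} := by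
    intro t
    refine poGen_min ⟨fun j => Or.inl rfl, ?_⟩ ?_
    · intro j k l h1 h2
      rcases h1 with h1 | h1 <;> rcases h2 with h2 | h2
      · exact Or.inl (Eq.trans h1 h2)
      · simp only at h1; subst h1; exact Or.inr h2
      · simp only at h2; subst h2; exact Or.inr h1
      · exact Or.inr ⟨h1.1, h2.2⟩
    · rintro p ⟨x, hx, rfl, _⟩
      exact Or.inr ⟨Or.inl ⟨x, hx, rfl⟩, Or.inr ⟨x, hx, rfl⟩⟩
  intro j hj
  simp only [suppY, Set.mem_iUnion] at hj
  obtain ⟨t, k, hk, h | h⟩ := hj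
  · rcases key t h with h | h
    · exact absurd h.symm hk
    · exact h.1
  · rcases key t h with h | h
    · exact absurd h hk
    · exact h.2

theorem join_gen (S T : Set (OffDiag M × ℝ≥0)) : joinY (gen S) (gen T) = gen (S ∪ T) := by
  funext t
  apply Set.Subset.antisymm
  · refine poGen_min (isPO_poGen _) (Set.union_subset ?_ ?_)
    · exact poGen_mono fun _ ⟨x, hx, h⟩ => ⟨x, Or.inl hx, h⟩
    · exact poGen_mono fun _ ⟨x, hx, h⟩ => ⟨x, Or.inr hx, h⟩
  · refine poGen_min (isPO_poGen _) ?_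
    rintro p ⟨x, hx | hx, h⟩
    · exact subset_poGen _ (Or.inl (subset_poGen _ ⟨x, hx, h⟩))
    · exact subset_poGen _ (Or.inr (subset_poGen _ ⟨x, hx, h⟩))

/-- domination criterion -/
theorem gen_union_eq {S T : Set (OffDiag M × ℝ≥0)}
    (h : ∀ x ∈ S, ∀ t, x.2 < t → x.1.1 ∈ gen T t) : gen (S ∪ T) = gen T := by
  funext t
  apply Set.Subset.antisymm
  · refine poGen_min (isPO_poGen _) ?_
    rintro p ⟨x, hx | hx, rfl, hl⟩
    · exact h x hx t hl
    · exact subset_poGen _ ⟨x, hx, rfl, hl⟩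
  · exact poGen_mono fun _ ⟨x, hx, h⟩ => ⟨x, Or.inr hx, h⟩

theorem gen_empty : gen (∅ : Set (OffDiag M × ℝ≥0)) = fun _ => diagRel M := by
  funext t
  apply Set.Subset.antisymm
  · refine poGen_min isPO_diag ?_
    rintro p ⟨x, hx, _⟩
    exact absurd hx (by simp)
  · rintro ⟨j, k⟩ h
    obtain rfl : j = k := h
    exact (isPO_poGen _).1 j

theorem shift_gen (S : Set (OffDiag M × ℝ≥0)) (ε : ℝ≥0) :
    shiftY (gen S) ε = gen ((fun x => (x.1, x.2 + ε)) '' S) := by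
  funext t
  show poGen (act S (t - ε)) = poGen (act _ t)
  congr 1
  ext p
  constructor
  · rintro ⟨x, hx, hp, hl⟩
    exact ⟨_, ⟨x, hx, rfl⟩, hp, lt_tsub_iff_right.1 hl⟩
  · rintro ⟨_, ⟨x, hx, rfl⟩, hp, hl⟩
    exact ⟨x, hx, hp, lt_tsub_iff_right.2 hl⟩

theorem Qtilde_gen (S : Set (OffDiag M × ℝ≥0)) :
    Qtilde (gen S) = {f : tildeY M | ∀ x ∈ S, f.1 x.1 ≤ (x.2 : ℝ≥0∞)} := by
  ext f
  constructor
  · intro h x hx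
    refine (h x.1).trans ?_
    refine le_of_forall_gt fun c hc => ?_
    obtain ⟨r, h1, h2⟩ := ENNReal.lt_iff_exists_nnreal_btwn.1 hc
    refine lt_of_le_of_lt ?_ h2
    have hm : x.1.1 ∈ gen S r := subset_poGen _ ⟨x, hx, rfl, ENNReal.coe_lt_coe.1 h1⟩
    exact iInf₂_le r hm
  · intro h p
    refine le_iInf₂ fun s hs => ?_
    have key : gen S s ⊆ {p | ∀ hp : p.1 ≠ p.2, f.1 ⟨p, hp⟩ ≤ s} := by
      refine poGen_min ⟨fun j hj => absurd rfl hj, ?_⟩ ?_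
      · intro j k l h1 h2 hjl
        by_cases hjk : j = k
        · subst hjk; exact h2 hjl
        by_cases hkl : k = l
        · subst hkl; exact h1 hjl
        exact (f.2 j k l hjk hkl hjl).trans (max_le (h1 hjk) (h2 hkl))
      · rintro _ ⟨x, hx, rfl, hl⟩ hp
        exact (h x hx).trans (ENNReal.coe_le_coe.2 hl.le)
    exact key hs p.2

theorem exists_gen {Z : ℝ≥0 → Set (M × M)} (hZ : MemZ Z) :
    ∃ S : Set (OffDiag M × ℝ≥0), S.Finite ∧ Z = gen S := by
  obtain ⟨⟨hpo, h0, hmono, hlc⟩, hfin⟩ := hZ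
  refine ⟨{x | fYo Z x.1 = (x.2 : ℝ≥0∞)}, ?_, ?_⟩
  · have hinj : Set.InjOn (fun x : OffDiag M × ℝ≥0 => x.1.1) {x | fYo Z x.1 = (x.2 : ℝ≥0∞)} := by
      intro x hx y hy hxy
      have e : x.1 = y.1 := Subtype.ext hxy
      have hx' : fYo Z x.1 = (x.2 : ℝ≥0∞) := hx
      have hy' : fYo Z y.1 = (y.2 : ℝ≥0∞) := hy
      rw [e, hy'] at hx'
      exact Prod.ext e (ENNReal.coe_injective hx'.symm)
    refine Set.Finite.of_finite_image ?_ hinj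
    refine (hfin.prod hfin).subset ?_
    rintro _ ⟨x, hx, rfl⟩
    have hx' : fYo Z x.1 = (x.2 : ℝ≥0∞) := hx
    have : fYo Z x.1 < ∞ := by rw [hx']; exact ENNReal.coe_lt_top
    simp only [fYo, fY, iInf_lt_iff] at this
    obtain ⟨s, hs, _⟩ := this
    constructor
    · simp only [suppY, Set.mem_iUnion]
      exact ⟨s, x.1.1.2, x.1.2.symm, Or.inl hs⟩
    · simp only [suppY, Set.mem_iUnion]
      exact ⟨s, x.1.1.1, x.1.2, Or.inr hs⟩
  · funext t
    apply Set.Subset.antisymm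
    · rintro p hp
      by_cases hd : p.1 = p.2
      · have := (isPO_poGen (act {x | fYo Z x.1 = (x.2 : ℝ≥0∞)} t)).1 p.1
        nth_rw 2 [hd] at this
        exact this
      · have ht : 0 < t := by
          rcases eq_or_lt_of_le (zero_le : 0 ≤ t) with h | h
          · rw [← h, h0] at hp
            exact absurd hp hd
          · exact h
        rw [hlc t ht] at hp
        simp only [Set.mem_iUnion] at hp
        obtain ⟨s, hs, hp⟩ := hp
        have hle : fYo Z ⟨p, hd⟩ ≤ s := iInf₂_le s hp
        have hne : fYo Z ⟨p, hd⟩ ≠ ∞ := ne_top_of_le_ne_top ENNReal.coe_ne_top hle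
        refine subset_poGen _ ⟨(⟨p, hd⟩, (fYo Z ⟨p, hd⟩).toNNReal), ?_, rfl, ?_⟩
        · exact (ENNReal.coe_toNNReal hne).symm
        · rw [← ENNReal.coe_lt_coe, ENNReal.coe_toNNReal hne]
          exact hle.trans_lt (ENNReal.coe_lt_coe.2 hs)
    · refine poGen_min (hpo t) ?_
      rintro _ ⟨x, hx, rfl, hl⟩
      have hx' : fYo Z x.1 = (x.2 : ℝ≥0∞) := hx
      have : fYo Z x.1 < t := by rw [hx']; exact ENNReal.coe_lt_coe.2 hl
      simp only [fYo, fY, iInf_lt_iff] at this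
      obtain ⟨s, hs, hst⟩ := this
      exact hmono s t (ENNReal.coe_lt_coe.1 hst).le hs

end GenSec

section MainSec
variable {M : Type*}

theorem phi_mono {φ : (ℝ≥0 → Set (M × M)) → ℝ} (hpos : PosDefZ φ)
    {S T : Set (OffDiag M × ℝ≥0)} (hS : S.Finite) (hT : T.Finite)
    (h : ∀ x ∈ S, ∀ t, x.2 < t → x.1.1 ∈ gen T t) : φ (gen T) ≤ φ (gen S) := by
  have := hpos 2 ![gen S, gen T] (by
    intro i; fin_cases i
    · exact memZ_gen hS
    · exact memZ_gen hT) ![1, -1]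
  have e : gen (T ∪ S) = gen T := by rw [Set.union_comm, gen_union_eq h]
  simp [Fin.sum_univ_two, join_gen, gen_union_eq h, e] at this
  linarith

theorem measurableSet_tildeY [Countable M] : MeasurableSet (tildeY M) := by
  have : tildeY M = ⋂ (j : M) (k : M) (l : M) (hjk : j ≠ k) (hkl : k ≠ l) (hjl : j ≠ l),
      {f : OffDiag M → ℝ≥0∞ | f ⟨(j, l), hjl⟩ ≤ max (f ⟨(j, k), hjk⟩) (f ⟨(k, l), hkl⟩)} := by
    ext f; simp [tildeY]
  rw [this]
  refine MeasurableSet.iInter fun j => MeasurableSet.iInter fun k => MeasurableSet.iInter fun l =>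
    MeasurableSet.iInter fun hjk => MeasurableSet.iInter fun hkl => MeasurableSet.iInter fun hjl => ?_
  exact measurableSet_le (measurable_pi_apply _)
    ((measurable_pi_apply (⟨(j, k), hjk⟩ : OffDiag M)).max
      (measurable_pi_apply (⟨(k, l), hkl⟩ : OffDiag M)))

theorem measurableSet_Q {S : Set (OffDiag M × ℝ≥0)} (hS : S.Finite) :
    MeasurableSet (Qtilde (gen S)) := by
  have : Qtilde (gen S) = ⋂ x ∈ S, {f : tildeY M | f.1 x.1 ≤ (x.2 : ℝ≥0∞)} := by
    rw [Qtilde_gen]; ext f; simp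
  rw [this]
  refine MeasurableSet.biInter hS.countable fun x _ => ?_
  exact measurableSet_le ((measurable_pi_apply _).comp measurable_subtype_coe) measurable_const

theorem uniq_measure (μ ν : Measure (tildeY M)) [IsProbabilityMeasure μ] [IsProbabilityMeasure ν]
    (h : ∀ S : Set (OffDiag M × ℝ≥0), S.Finite → μ (Qtilde (gen S)) = ν (Qtilde (gen S))) :
    μ = ν := by
  refine ext_of_generate_finite {A | ∃ S : Set (OffDiag M × ℝ≥0), S.Finite ∧ A = Qtilde (gen S)}
    ?_ ?_ ?_ (by simp)
  · apply le_antisymm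
    · have : Measurable[MeasurableSpace.generateFrom
          {A | ∃ S : Set (OffDiag M × ℝ≥0), S.Finite ∧ A = Qtilde (gen S)}]
          (Subtype.val : tildeY M → OffDiag M → ℝ≥0∞) := by
        refine @measurable_pi_lambda _ _ _ (_) _ _ fun p => ?_
        refine @measurable_of_Iic ℝ≥0∞ _ _ _ _ (_) _ _ inferInstance _ fun a => ?_
        induction a using ENNReal.recTopCoe with
        | top =>
          simp only [Set.Iic_top, Set.preimage_univ]
          exact @MeasurableSet.univ _ (_)
        | coe a =>
          refine MeasurableSpace.measurableSet_generateFrom ⟨{(p, a)}, Set.finite_singleton _, ?_⟩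
          rw [Qtilde_gen]; ext f; simp
      exact measurable_iff_comap_le.1 this
    · refine MeasurableSpace.generateFrom_le ?_
      rintro _ ⟨S, hS, rfl⟩
      exact measurableSet_Q hS
  · rintro _ ⟨S, hS, rfl⟩ _ ⟨T, hT, rfl⟩ _
    refine ⟨S ∪ T, hS.union hT, ?_⟩
    simp only [Qtilde_gen]
    ext f
    simp only [Set.mem_inter_iff, Set.mem_ofPred_eq, Set.mem_union]
    constructor
    · rintro ⟨h1, h2⟩ x (hx | hx)
      · exact h1 x hx
      · exact h2 x hx
    · intro h
      exact ⟨fun x hx => h x (Or.inl hx), fun x hx => h x (Or.inr hx)⟩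
  · rintro _ ⟨S, hS, rfl⟩
    exact h S hS

/-- embedding of the countable index set -/
def evi (d : ℕ → ℝ≥0) (i : OffDiag M × ℕ) : OffDiag M × ℝ≥0 := (i.1, d i.2)

/-- switching times of a configuration -/
noncomputable def swt (d : ℕ → ℝ≥0) (ω : OffDiag M × ℕ → Bool) (p : OffDiag M) : ℝ≥0∞ :=
  ⨅ n, if ω (p, n) = true then (d n : ℝ≥0∞) else ∞

theorem measurable_swt (d : ℕ → ℝ≥0) :
    Measurable (swt d : (OffDiag M × ℕ → Bool) → OffDiag M → ℝ≥0∞) := by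
  refine measurable_pi_lambda _ fun p => Measurable.iInf fun n => ?_
  have hs : MeasurableSet {ω : OffDiag M × ℕ → Bool | ω (p, n) = true} :=
    measurableSet_eq_fun (measurable_pi_apply (p, n)) measurable_const
  exact Measurable.ite hs
    measurable_const measurable_const

theorem swt_lt {d : ℕ → ℝ≥0} {ω : OffDiag M × ℕ → Bool} {p : OffDiag M} {a : ℝ≥0∞} :
    swt d ω p < a ↔ ∃ n, ω (p, n) = true ∧ (d n : ℝ≥0∞) < a := by
  rw [swt, iInf_lt_iff]
  refine exists_congr fun n => ?_
  by_cases h : ω (p, n) = true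
  · simp [h]
  · simp [h]

theorem swt_le {d : ℕ → ℝ≥0} {ω : OffDiag M × ℕ → Bool} {p : OffDiag M} {n : ℕ}
    (h : ω (p, n) = true) : swt d ω p ≤ d n := by
  refine (iInf_le _ n).trans ?_
  simp [h]

theorem exists_dseq : ∃ d : ℕ → ℝ≥0, ∀ a b : ℝ≥0∞, a < b → ∃ n, a < d n ∧ (d n : ℝ≥0∞) < b := by
  refine ⟨TopologicalSpace.denseSeq ℝ≥0, fun a b hab => ?_⟩
  obtain ⟨r, h1, h2⟩ := ENNReal.lt_iff_exists_nnreal_btwn.1 hab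
  obtain ⟨s, h3, h4⟩ := ENNReal.lt_iff_exists_nnreal_btwn.1 h2
  obtain ⟨_, ⟨n, rfl⟩, hn⟩ := (TopologicalSpace.denseRange_denseSeq ℝ≥0).exists_between
    (ENNReal.coe_lt_coe.1 h3)
  exact ⟨n, h1.trans (ENNReal.coe_lt_coe.2 hn.1), (ENNReal.coe_lt_coe.2 hn.2).trans h4⟩

/-- The deterministic consistency property of configurations. -/
def Good (d : ℕ → ℝ≥0) (ω : OffDiag M × ℕ → Bool) : Prop :=
  ∀ (B : Finset (OffDiag M × ℕ)) (i : OffDiag M × ℕ),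
    (∀ t, d i.2 < t → i.1.1 ∈ gen (evi d '' (B : Set (OffDiag M × ℕ))) t) →
    ω ∈ cyl B → ω i = true

theorem Good.mono {d : ℕ → ℝ≥0} {ω : OffDiag M × ℕ → Bool} (h : Good d ω) {p : OffDiag M}
    {m n : ℕ} (hmn : d m ≤ d n) (hm : ω (p, m) = true) : ω (p, n) = true := by
  refine h {(p, m)} (p, n) ?_ (by simpa [cyl] using hm)
  intro t ht
  exact subset_poGen _ ⟨(p, d m), ⟨(p, m), by simp, rfl⟩, rfl, hmn.trans_lt ht⟩

theorem Good.mem_tildeY {d : ℕ → ℝ≥0}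
    (hd : ∀ a b : ℝ≥0∞, a < b → ∃ n, a < d n ∧ (d n : ℝ≥0∞) < b)
    {ω : OffDiag M × ℕ → Bool} (h : Good d ω) : swt d ω ∈ tildeY M := by
  classical
  intro j k l hjk hkl hjl
  by_contra! hlt
  obtain ⟨n, h1, h2⟩ := hd _ _ hlt
  obtain ⟨m1, hm1, hl1⟩ := swt_lt.1 ((le_max_left _ _).trans_lt h1)
  obtain ⟨m2, hm2, hl2⟩ := swt_lt.1 ((le_max_right _ _).trans_lt h1)
  have a1 := h.mono (ENNReal.coe_lt_coe.1 hl1).le hm1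
  have a2 := h.mono (ENNReal.coe_lt_coe.1 hl2).le hm2
  have a3 : ω (⟨(j, l), hjl⟩, n) = true := by
    refine h {(⟨(j, k), hjk⟩, n), (⟨(k, l), hkl⟩, n)} _ ?_ (by simp [cyl, a1, a2])
    intro t ht
    refine (isPO_poGen _).2 j k l (subset_poGen _ ?_) (subset_poGen _ ?_)
    · exact ⟨(⟨(j, k), hjk⟩, d n), ⟨(⟨(j, k), hjk⟩, n), by simp, rfl⟩, rfl, ht⟩
    · exact ⟨(⟨(k, l), hkl⟩, d n), ⟨(⟨(k, l), hkl⟩, n), by simp, rfl⟩, rfl, ht⟩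
  exact absurd (swt_le a3) (not_le.2 h2)

theorem ae_good [Countable M] {φ : (ℝ≥0 → Set (M × M)) → ℝ} (d : ℕ → ℝ≥0)
    (ν : Measure (OffDiag M × ℕ → Bool)) [IsProbabilityMeasure ν]
    (hν : ∀ B : Finset (OffDiag M × ℕ), ν (cyl B) =
      ENNReal.ofReal (φ (gen (evi d '' (B : Set (OffDiag M × ℕ)))))) :
    ∀ᵐ ω ∂ν, Good d ω := by
  classical
  simp only [Good]
  rw [ae_all_iff]; intro B
  rw [ae_all_iff]; intro i
  rw [Filter.eventually_imp_distrib_left]; intro hi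
  have hsub : cyl (insert i B) ⊆ cyl B := by
    intro ω hω j hj
    exact hω j (Finset.mem_insert_of_mem hj)
  have heq : ν (cyl (insert i B)) = ν (cyl B) := by
    rw [hν, hν]
    congr 2
    have : evi d '' ((insert i B : Finset (OffDiag M × ℕ)) : Set (OffDiag M × ℕ))
        = {evi d i} ∪ evi d '' (B : Set (OffDiag M × ℕ)) := by
      rw [Finset.coe_insert, Set.image_insert_eq, Set.singleton_union]
    rw [this]
    apply gen_union_eq
    rintro _ rfl t ht
    exact hi t ht
  have := ae_eq_of_subset_of_measure_ge hsub heq.ge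
    (measurableSet_cyl _).nullMeasurableSet (measure_ne_top _ _)
  filter_upwards [this] with ω hω hB
  have h2 : ω ∈ cyl (insert i B) := (iff_of_eq hω).2 hB
  exact h2 i (Finset.mem_insert_self _ _)

theorem value_eq [Countable M] {φ : (ℝ≥0 → Set (M × M)) → ℝ} (hpos : PosDefZ φ)
    (hcont : ContFromBelow φ) {d : ℕ → ℝ≥0}
    (hd : ∀ a b : ℝ≥0∞, a < b → ∃ n, a < d n ∧ (d n : ℝ≥0∞) < b)
    (ν : Measure (OffDiag M × ℕ → Bool)) [IsProbabilityMeasure ν]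
    (hν : ∀ B : Finset (OffDiag M × ℕ), ν (cyl B) =
      ENNReal.ofReal (φ (gen (evi d '' (B : Set (OffDiag M × ℕ))))))
    {S : Set (OffDiag M × ℝ≥0)} (hS : S.Finite) :
    ν {ω | swt d ω ∈ tildeY M ∧ ∀ x ∈ S, swt d ω x.1 ≤ (x.2 : ℝ≥0∞)} =
      ENNReal.ofReal (φ (gen S)) := by
  classical
  let e : ℕ → ℝ≥0 := fun n => 1 / ((n : ℝ≥0) + 1)
  have hepos : ∀ n, 0 < e n := fun n => by positivity
  have heanti : Antitone e := by
    intro m n hmn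
    simp only [e]
    gcongr
  have helim : Filter.Tendsto e Filter.atTop (nhds 0) := tendsto_one_div_add_atTop_nhds_zero_nat
  have hq : ∀ (n : ℕ) (x : ℝ≥0), ∃ k, x < d k ∧ d k < x + e n := by
    intro n x
    obtain ⟨k, h1, h2⟩ := hd x ((x + e n : ℝ≥0) : ℝ≥0∞)
      (ENNReal.coe_lt_coe.2 (lt_add_of_pos_right _ (hepos n)))
    exact ⟨k, ENNReal.coe_lt_coe.1 h1, ENNReal.coe_lt_coe.1 h2⟩
  choose q hq1 hq2 using hq
  let B : ℕ → Finset (OffDiag M × ℕ) := fun n =>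
    (Finset.range (n + 1)).biUnion fun m => hS.toFinset.image fun x => (x.1, q m x.2)
  have hB : ∀ n i, i ∈ B n ↔ ∃ m ≤ n, ∃ x ∈ S, (x.1, q m x.2) = i := by
    intro n i
    simp only [B, Finset.mem_biUnion, Finset.mem_image, Set.Finite.mem_toFinset, Finset.mem_range,
      Nat.lt_succ_iff]
  have hfinB : ∀ n, (evi d '' (B n : Set (OffDiag M × ℕ))).Finite :=
    fun n => (B n).finite_toSet.image _
  -- lower bound
  have hlow : ∀ n, φ (gen S) ≤ φ (gen (evi d '' (B n : Set (OffDiag M × ℕ)))) := by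
    intro n
    refine phi_mono hpos (hfinB n) hS ?_
    rintro _ ⟨i, hi, rfl⟩ t ht
    obtain ⟨m, hm, x, hx, rfl⟩ := (hB n i).1 hi
    exact subset_poGen _ ⟨x, hx, rfl, (hq1 m x.2).trans ht⟩
  have hup : ∀ n, φ (gen (evi d '' (B n : Set (OffDiag M × ℕ)))) ≤ φ (shiftY (gen S) (e n)) := by
    intro n
    rw [shift_gen]
    refine phi_mono hpos (hS.image _) (hfinB n) ?_
    rintro _ ⟨x, hx, rfl⟩ t ht
    exact subset_poGen _ ⟨(x.1, d (q n x.2)), ⟨(x.1, q n x.2), (hB n _).2 ⟨n, le_rfl, x, hx, rfl⟩,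
      rfl⟩, rfl, (hq2 n x.2).trans ht⟩
  have hlim1 : Filter.Tendsto (fun n => φ (shiftY (gen S) (e n))) Filter.atTop
      (nhds (φ (gen S))) := by
    refine (hcont _ (memZ_gen hS)).comp ?_
    exact tendsto_nhdsWithin_iff.2 ⟨helim, Filter.Eventually.of_forall hepos⟩
  have hlim2 : Filter.Tendsto (fun n => φ (gen (evi d '' (B n : Set (OffDiag M × ℕ)))))
      Filter.atTop (nhds (φ (gen S))) :=
    tendsto_of_tendsto_of_tendsto_of_le_of_le tendsto_const_nhds hlim1 hlow hup
  have hlim3 : Filter.Tendsto (fun n => ν (cyl (B n))) Filter.atTop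
      (nhds (ENNReal.ofReal (φ (gen S)))) := by
    simp only [hν]
    exact ENNReal.tendsto_ofReal hlim2
  have hantiB : Antitone fun n => cyl (B n) := by
    intro m n hmn ω hω i hi
    obtain ⟨k, hk, h⟩ := (hB m i).1 hi
    exact hω i ((hB n i).2 ⟨k, hk.trans hmn, h⟩)
  have hlim4 : Filter.Tendsto (fun n => ν (cyl (B n))) Filter.atTop
      (nhds (ν (⋂ n, cyl (B n)))) :=
    tendsto_measure_iInter_atTop (fun n => (measurableSet_cyl _).nullMeasurableSet) hantiB
      ⟨0, measure_ne_top _ _⟩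
  rw [← tendsto_nhds_unique hlim4 hlim3]
  refine measure_congr ?_
  filter_upwards [ae_good (φ := φ) d ν hν] with ω hω
  refine propext ?_
  show (swt d ω ∈ tildeY M ∧ ∀ x ∈ S, swt d ω x.1 ≤ (x.2 : ℝ≥0∞)) ↔ ω ∈ ⋂ n, cyl (B n)
  constructor
  · rintro ⟨-, h⟩
    refine Set.mem_iInter.2 fun n i hi => ?_
    obtain ⟨m, hm, x, hx, rfl⟩ := (hB n i).1 hi
    obtain ⟨k, hk, hlt⟩ := swt_lt.1 ((h x hx).trans_lt (ENNReal.coe_lt_coe.2 (hq1 m x.2)))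
    exact hω.mono (ENNReal.coe_lt_coe.1 hlt).le hk
  · intro h
    refine ⟨hω.mem_tildeY hd, fun x hx => ?_⟩
    have hb : ∀ n, swt d ω x.1 ≤ ((x.2 + e n : ℝ≥0) : ℝ≥0∞) := by
      intro n
      have := Set.mem_iInter.1 h n _ ((hB n _).2 ⟨n, le_rfl, x, hx, rfl⟩)
      exact (swt_le this).trans (ENNReal.coe_le_coe.2 (hq2 n x.2).le)
    have hl : Filter.Tendsto (fun n => ((x.2 + e n : ℝ≥0) : ℝ≥0∞)) Filter.atTop
        (nhds ((x.2 : ℝ≥0) : ℝ≥0∞)) := by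
      refine ENNReal.tendsto_coe.2 ?_
      simpa using tendsto_const_nhds.add helim
    exact ge_of_tendsto' hl hb

theorem exists_measure [Countable M] (φ : (ℝ≥0 → Set (M × M)) → ℝ)
    (hnorm : φ (fun _ : ℝ≥0 => diagRel M) = 1)
    (hpos : PosDefZ φ) (hcont : ContFromBelow φ) :
    ∃ μ : Measure (tildeY M), IsProbabilityMeasure μ ∧
      ∀ S : Set (OffDiag M × ℝ≥0), S.Finite →
        μ (Qtilde (gen S)) = ENNReal.ofReal (φ (gen S)) := by
  classical
  obtain ⟨d, hd⟩ := exists_dseq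
  obtain ⟨ν, hp, hν⟩ := exists_cube_measure
    (fun B : Finset (OffDiag M × ℕ) => φ (gen (evi d '' (B : Set (OffDiag M × ℕ))))) (by
      intro κ _ B c
      let eq := Fintype.equivFin κ
      have := hpos (Fintype.card κ)
        (fun i => gen (evi d '' (B (eq.symm i) : Set (OffDiag M × ℕ))))
        (fun i => memZ_gen ((B _).finite_toSet.image _)) (fun i => c (eq.symm i))
      refine this.trans_eq ?_
      rw [← eq.symm.sum_comp]
      refine Finset.sum_congr rfl fun i _ => ?_
      rw [← eq.symm.sum_comp]
      refine Finset.sum_congr rfl fun j _ => ?_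
      simp only [join_gen, Finset.coe_union, Set.image_union]) (by
      simp [gen_empty, hnorm])
  have hval : ∀ S : Set (OffDiag M × ℝ≥0), S.Finite →
      (Measure.comap Subtype.val (ν.map (swt d)) : Measure (tildeY M)) (Qtilde (gen S))
        = ENNReal.ofReal (φ (gen S)) := by
    intro S hS
    have hemb := MeasurableEmbedding.subtype_coe (measurableSet_tildeY (M := M))
    rw [hemb.comap_apply, Measure.map_apply (measurable_swt d)
      (hemb.measurableSet_image.2 (measurableSet_Q hS)), ← value_eq hpos hcont hd ν hν hS]
    congr 1
    ext ω
    rw [Qtilde_gen]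
    constructor
    · rintro ⟨f, hf, hfe⟩
      refine ⟨hfe ▸ f.2, ?_⟩
      rw [← hfe]
      exact hf
    · rintro ⟨h1, h2⟩
      exact ⟨⟨swt d ω, h1⟩, h2, rfl⟩
  refine ⟨_, ⟨?_⟩, hval⟩
  have := hval ∅ Set.finite_empty
  rw [gen_empty, hnorm, ← gen_empty, Qtilde_gen] at this
  simpa using this

end MainSec
/-- A normalised, positive definite, below-continuous function on `𝒵` is
represented by a unique Borel probability measure on `𝒴̃` via `φ(Z) = μ(Q̃_Z)`. -/
theorem measure_of_phi {M : Type*} [Countable M] [Infinite M]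
    (φ : (ℝ≥0 → Set (M × M)) → ℝ)
    (hnorm : φ (fun _ : ℝ≥0 => diagRel M) = 1)
    (hpos : PosDefZ φ) (hcont : ContFromBelow φ) :
    ∃! μ : MeasureTheory.Measure (tildeY M),
      MeasureTheory.IsProbabilityMeasure μ ∧
        ∀ Z : ℝ≥0 → Set (M × M), MemZ Z → φ Z = (μ (Qtilde Z)).toReal := by
  obtain ⟨μ, hμ, hval⟩ := exists_measure φ hnorm hpos hcont
  have hnn : ∀ S : Set (OffDiag M × ℝ≥0), S.Finite → 0 ≤ φ (gen S) := by
    intro S hS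
    have := hpos 1 (fun _ => gen S) (fun _ => memZ_gen hS) (fun _ => 1)
    simpa [join_gen] using this
  refine ⟨μ, ⟨hμ, ?_⟩, ?_⟩
  · intro Z hZ
    obtain ⟨S, hS, rfl⟩ := exists_gen hZ
    rw [hval S hS, ENNReal.toReal_ofReal (hnn S hS)]
  · rintro μ' ⟨hμ', h'⟩
    refine uniq_measure μ' μ fun S hS => ?_
    rw [hval S hS, h' _ (memZ_gen hS), ENNReal.ofReal_toReal (measure_ne_top _ _)]
end

section
/- Let (μ_n)_{n ∈ ℕ} and μ be Borel probability measures on the compact metrizable space 𝒴̃. Then μ_n converges weakly to μ (that is, ∫ g dμ_n → ∫ g dμ for every continuous g : 𝒴̃ → ℝ) if and only if μ_n(Q̃_Z) → μ(Q̃_Z) for every Z ∈ 𝒵 with μ(∂Q̃_Z) = 0, where ∂Q̃_Z denotes the topological boundary of Q̃_Z in 𝒴̃. -/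
open Set NNReal ENNReal

open MeasureTheory Filter Topology

lemma isClosed_tildeY (M : Type*) : IsClosed (tildeY M) := by
  have : tildeY M = ⋂ (j : M) (k : M) (l : M) (hjk : j ≠ k) (hkl : k ≠ l) (hjl : j ≠ l),
      {f : OffDiag M → ℝ≥0∞ | f ⟨(j, l), hjl⟩ ≤ max (f ⟨(j, k), hjk⟩) (f ⟨(k, l), hkl⟩)} := by
    ext f; simp only [tildeY, mem_ofPred_eq, mem_iInter]
  rw [this]
  refine isClosed_iInter fun j => isClosed_iInter fun k => isClosed_iInter fun l =>
    isClosed_iInter fun _ => isClosed_iInter fun _ => isClosed_iInter fun _ => ?_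
  exact isClosed_le (continuous_apply _)
    (Continuous.max (continuous_apply (⟨(j, k), _⟩ : OffDiag M))
      (continuous_apply (⟨(k, l), _⟩ : OffDiag M)))

lemma compactSpace_tildeY (M : Type*) : CompactSpace (tildeY M) :=
  isCompact_iff_compactSpace.mp (isClosed_tildeY M).isCompact

/-- The order process attached to an ultrametric-type function. -/
def procOf {M : Type*} (F : OffDiag M → ℝ≥0∞) : ℝ≥0 → Set (M × M) :=
  fun t => {p | ∀ h : p.1 ≠ p.2, F ⟨p, h⟩ < t}

lemma memY_procOf {M : Type*} {F : OffDiag M → ℝ≥0∞} (hF : F ∈ tildeY M) : MemY (procOf F) := by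
  refine ⟨fun t => ⟨fun j h => absurd rfl h, ?_⟩, ?_, ?_, ?_⟩
  · intro j k l hjk hkl hjl
    by_cases h1 : j = k
    · subst h1; exact hkl hjl
    by_cases h2 : k = l
    · subst h2; exact hjk hjl
    exact (hF j k l h1 h2 hjl).trans_lt (max_lt (hjk h1) (hkl h2))
  · ext p
    simp [procOf, diagRel]
  · intro s t hst p hp h
    exact (hp h).trans_le (by exact_mod_cast hst)
  · intro t ht
    ext p
    simp only [mem_iUnion, mem_Iio, exists_prop]
    constructor
    · intro hp
      by_cases h : p.1 ≠ p.2
      · obtain ⟨s, hs1, hs2⟩ := ENNReal.lt_iff_exists_nnreal_btwn.mp (hp h)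
        exact ⟨s, by exact_mod_cast hs2, fun _ => hs1⟩
      · exact ⟨0, ht, fun h' => absurd h' h⟩
    · rintro ⟨s, hs, hp⟩ h
      exact (hp h).trans (by exact_mod_cast hs)

lemma fYo_procOf {M : Type*} (F : OffDiag M → ℝ≥0∞) : fYo (procOf F) = F := by
  ext p
  simp only [fYo, fY]
  apply le_antisymm
  · refine le_of_forall_gt fun c hc => ?_
    obtain ⟨s, hs1, hs2⟩ := ENNReal.lt_iff_exists_nnreal_btwn.mp hc
    exact (iInf₂_le s (fun _ => hs1)).trans_lt hs2
  · exact le_iInf₂ fun s hs => (hs p.2).le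

/-- Finite-dimensional lower rectangles. -/
def rect {M : Type*} (L : List (OffDiag M × ℝ≥0)) : Set (tildeY M) :=
  {f | ∀ q ∈ L, f.1 q.1 ≤ q.2}

lemma exists_Z_rect {M : Type*} (L : List (OffDiag M × ℝ≥0)) :
    ∃ Z : ℝ≥0 → Set (M × M), MemZ Z ∧ Qtilde Z = rect L := by
  classical
  let F : OffDiag M → ℝ≥0∞ := fun p => ⨆ f ∈ rect L, f.1 p
  have hle : ∀ f ∈ rect L, ∀ p, f.1 p ≤ F p := fun f hf p =>
    le_iSup₂ (f := fun (f : tildeY M) (_ : f ∈ rect L) => f.1 p) f hf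
  have hF : F ∈ tildeY M := by
    intro j k l h1 h2 h3
    refine iSup₂_le fun f hf => (f.2 j k l h1 h2 h3).trans (max_le_max (hle f hf _) (hle f hf _))
  let A : Set M := {a | ∃ q ∈ L, a = q.1.1.1 ∨ a = q.1.1.2}
  have hA : A.Finite := by
    have : A = ⋃ q ∈ {q | q ∈ L}, {q.1.1.1, q.1.1.2} := by
      ext a; simp [A]
    rw [this]
    exact (List.finite_toSet L).biUnion fun q _ => Set.toFinite _
  let g : OffDiag M → ℝ≥0∞ := fun p => if p.1.1 ∈ A ∧ p.1.2 ∈ A then 0 else ⊤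
  have hg : g ∈ tildeY M := by
    intro j k l h1 h2 h3
    simp only [g]
    by_cases ha : j ∈ A <;> by_cases hb : l ∈ A <;> simp [ha, hb]
  have hgr : (⟨g, hg⟩ : tildeY M) ∈ rect L := by
    intro q hq
    have h1 : q.1.1.1 ∈ A := ⟨q, hq, Or.inl rfl⟩
    have h2 : q.1.1.2 ∈ A := ⟨q, hq, Or.inr rfl⟩
    simp [g, h1, h2]
  have key : ∀ p : OffDiag M, F p ≠ ⊤ → p.1.1 ∈ A ∧ p.1.2 ∈ A := by
    intro p hp
    by_contra hn
    apply hp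
    have := hle _ hgr p
    simpa [g, hn] using this
  refine ⟨procOf F, ⟨memY_procOf hF, hA.subset ?_⟩, ?_⟩
  · intro a ha
    simp only [suppY, mem_iUnion, suppV, mem_ofPred_eq] at ha
    obtain ⟨t, k, hk, h | h⟩ := ha
    · exact (key ⟨(a, k), hk.symm⟩ (h hk.symm).ne_top).1
    · exact (key ⟨(k, a), hk⟩ (h hk).ne_top).2
  · ext f
    simp only [Qtilde, fYo_procOf, mem_ofPred_eq]
    constructor
    · intro h q hq
      exact (h q.1).trans (iSup₂_le fun f hf => hf q hq)
    · intro h p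
      exact hle f h p

lemma continuous_coord {M : Type*} (p : OffDiag M) :
    Continuous (fun f : tildeY M => f.1 p) :=
  (continuous_apply p).comp continuous_subtype_val

lemma measurable_coord {M : Type*} (p : OffDiag M) :
    Measurable (fun f : tildeY M => f.1 p) :=
  (measurable_pi_apply p).comp measurable_subtype_coe

lemma isClosed_rect {M : Type*} (L : List (OffDiag M × ℝ≥0)) : IsClosed (rect L) := by
  have : rect L = ⋂ q ∈ L, {f : tildeY M | f.1 q.1 ≤ q.2} := by
    ext f; simp [rect]
  rw [this]
  exact isClosed_biInter fun q _ => isClosed_le (continuous_coord _) continuous_const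

lemma frontier_rect {M : Type*} (μ : Measure (tildeY M)) (L : List (OffDiag M × ℝ≥0))
    (hL : ∀ q ∈ L, μ {f | f.1 q.1 = q.2} = 0) : μ (frontier (rect L)) = 0 := by
  have h0 : μ (⋃ q ∈ {q | q ∈ L}, {f : tildeY M | f.1 q.1 = q.2}) = 0 :=
    (measure_biUnion_null_iff (List.finite_toSet L).countable).mpr hL
  refine measure_mono_null ?_ h0
  intro f hf
  rw [(isClosed_rect L).frontier_eq] at hf
  by_contra hn
  apply hf.2
  simp only [mem_iUnion, not_exists, mem_ofPred_eq] at hn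
  rw [mem_interior]
  refine ⟨⋂ q ∈ {q | q ∈ L}, {f : tildeY M | f.1 q.1 < q.2}, ?_, ?_, ?_⟩
  · intro x hx q hq
    simp only [mem_iInter] at hx
    exact (hx q hq).le
  · exact (List.finite_toSet L).isOpen_biInter fun q _ =>
      isOpen_lt (continuous_coord _) continuous_const
  · simp only [mem_iInter]
    intro q hq
    exact lt_of_le_of_ne (hf.1 q hq) (hn q hq)

/-- The sets generated from generic lower half-spaces by intersections and differences. -/
inductive Good_s17 {M : Type*} (μ : Measure (tildeY M)) : Set (tildeY M) → Prop
  | univ : Good_s17 μ Set.univ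
  | le (A : Set (tildeY M)) (p : OffDiag M) (t : ℝ≥0) (hA : Good_s17 μ A)
      (h : μ {f | f.1 p = t} = 0) : Good_s17 μ (A ∩ {f | f.1 p ≤ t})
  | gt (A : Set (tildeY M)) (p : OffDiag M) (t : ℝ≥0) (hA : Good_s17 μ A)
      (h : μ {f | f.1 p = t} = 0) : Good_s17 μ (A \ {f | f.1 p ≤ t})

lemma Good_s17.inter {M : Type*} {μ : Measure (tildeY M)} {A B : Set (tildeY M)}
    (hA : Good_s17 μ A) (hB : Good_s17 μ B) : Good_s17 μ (A ∩ B) := by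
  induction hB with
  | univ => simpa using hA
  | le B p t _ h ih => rw [← inter_assoc]; exact ih.le _ p t h
  | gt B p t _ h ih => rw [← inter_sdiff_assoc]; exact ih.gt _ p t h

lemma Good_s17.measurable {M : Type*} {μ : Measure (tildeY M)} {A : Set (tildeY M)}
    (hA : Good_s17 μ A) : MeasurableSet A := by
  induction hA with
  | univ => exact MeasurableSet.univ
  | le B p t _ h ih => exact ih.inter (measurableSet_le (measurable_coord p) measurable_const)
  | gt B p t _ h ih => exact ih.diff (measurableSet_le (measurable_coord p) measurable_const)

lemma measurableSet_rect {M : Type*} (L : List (OffDiag M × ℝ≥0)) : MeasurableSet (rect L) := by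
  have : rect L = ⋂ q ∈ {q | q ∈ L}, {f : tildeY M | f.1 q.1 ≤ q.2} := by
    ext f; simp [rect]
  rw [this]
  exact MeasurableSet.biInter (List.finite_toSet L).countable
    fun q _ => measurableSet_le (measurable_coord _) measurable_const

lemma rect_cons {M : Type*} (L : List (OffDiag M × ℝ≥0)) (p : OffDiag M) (t : ℝ≥0) :
    rect ((p, t) :: L) = {f : tildeY M | f.1 p ≤ (t : ℝ≥0∞)} ∩ rect L := by
  ext f; simp [rect]

lemma Good_s17.tendsto {M : Type*} {μ : Measure (tildeY M)} [IsFiniteMeasure μ]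
    {μs : ℕ → Measure (tildeY M)} [∀ n, IsFiniteMeasure (μs n)]
    (hr : ∀ L : List (OffDiag M × ℝ≥0), (∀ q ∈ L, μ {f | f.1 q.1 = q.2} = 0) →
      Tendsto (fun n => (μs n).real (rect L)) atTop (𝓝 (μ.real (rect L))))
    {A : Set (tildeY M)} (hA : Good_s17 μ A) :
    ∀ L : List (OffDiag M × ℝ≥0), (∀ q ∈ L, μ {f | f.1 q.1 = q.2} = 0) →
      Tendsto (fun n => (μs n).real (A ∩ rect L)) atTop (𝓝 (μ.real (A ∩ rect L))) := by
  induction hA with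
  | univ => simpa using hr
  | le B p t _ h ih =>
    intro L hL
    rw [inter_assoc, ← rect_cons]
    refine ih _ fun q hq => ?_
    rcases List.mem_cons.mp hq with rfl | hq
    · exact h
    · exact hL q hq
  | gt B p t hB h ih =>
    intro L hL
    have e : (B \ {f : tildeY M | f.1 p ≤ (t : ℝ≥0∞)}) ∩ rect L = (B ∩ rect L) \ (B ∩ rect ((p, t) :: L)) := by
      rw [rect_cons]
      ext f
      simp only [mem_inter_iff, Set.mem_sdiff]
      tauto
    have hs : B ∩ rect ((p, t) :: L) ⊆ B ∩ rect L := by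
      rw [rect_cons]
      exact inter_subset_inter_right _ inter_subset_right
    have hm := hB.measurable.inter (measurableSet_rect ((p, t) :: L))
    rw [e]
    have hd : ∀ (ν : Measure (tildeY M)) [IsFiniteMeasure ν],
        ν.real ((B ∩ rect L) \ (B ∩ rect ((p, t) :: L))) =
          ν.real (B ∩ rect L) - ν.real (B ∩ rect ((p, t) :: L)) :=
      fun ν _ => measureReal_sdiff hs hm
    simp only [hd]
    refine (ih L hL).sub (ih _ ?_)
    intro q hq
    rcases List.mem_cons.mp hq with rfl | hq
    · exact h
    · exact hL q hq

lemma exists_generic {M : Type*} (μ : Measure (tildeY M)) [IsFiniteMeasure μ] (p : OffDiag M)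
    {a b : ℝ≥0∞} (hab : a < b) :
    ∃ t : ℝ≥0, a < t ∧ (t : ℝ≥0∞) < b ∧ μ {f | f.1 p = t} = 0 := by
  obtain ⟨c, hac, hcb⟩ := ENNReal.lt_iff_exists_nnreal_btwn.mp hab
  obtain ⟨d, hcd, hdb⟩ := ENNReal.lt_iff_exists_nnreal_btwn.mp hcb
  have hcnt : {t : ℝ≥0∞ | 0 < μ {f : tildeY M | f.1 p = t}}.Countable :=
    Measure.countable_meas_level_set_pos (measurable_coord p)
  have hcd' : (c : ℝ) < d := by exact_mod_cast hcd
  by_contra! hn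
  have : (Ioo (c : ℝ) d).Countable := by
    refine (hcnt.image ENNReal.toReal).mono ?_
    intro r hr
    have hr0 : 0 ≤ r := c.2.trans hr.1.le
    lift r to ℝ≥0 using hr0
    have h1 : c < r := by exact_mod_cast hr.1
    have h2 : r < d := by exact_mod_cast hr.2
    refine ⟨r, pos_iff_ne_zero.mpr (hn r (hac.trans ?_) (lt_trans ?_ hdb)), by simp⟩
    · exact_mod_cast h1
    · exact_mod_cast h2
  exact absurd hcd' (not_lt.mpr (by simpa using this))

lemma coord_nhds {M : Type*} (μ : Measure (tildeY M)) [IsFiniteMeasure μ] (p : OffDiag M)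
    (x : tildeY M) {V : Set ℝ≥0∞} (hV : V ∈ 𝓝 (x.1 p)) :
    ∃ s, Good_s17 μ s ∧ s ∈ 𝓝 x ∧ s ⊆ {f | f.1 p ∈ V} := by
  have h1 : ∃ s, Good_s17 μ s ∧ s ∈ 𝓝 x ∧ ∀ f ∈ s, x.1 p ≤ f.1 p → f.1 p ∈ V := by
    by_cases ha : x.1 p = ⊤
    · refine ⟨_, Good_s17.univ, univ_mem, fun f _ h => ?_⟩
      have : f.1 p = x.1 p := le_antisymm (ha ▸ le_top) h
      rw [this]; exact mem_of_mem_nhds hV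
    · obtain ⟨u, hu, huV⟩ := exists_Ico_subset_of_mem_nhds hV ⟨⊤, lt_top_iff_ne_top.mpr ha⟩
      obtain ⟨t, ht1, ht2, ht⟩ := exists_generic μ p hu
      refine ⟨_, Good_s17.univ.le _ p t ht, ?_, fun f hf h => huV ⟨h, hf.2.trans_lt ht2⟩⟩
      rw [univ_inter]
      filter_upwards [(isOpen_lt (continuous_coord p) continuous_const).mem_nhds ht1] with f hf
      exact le_of_lt hf
  have h2 : ∃ s, Good_s17 μ s ∧ s ∈ 𝓝 x ∧ ∀ f ∈ s, f.1 p ≤ x.1 p → f.1 p ∈ V := by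
    by_cases ha : x.1 p = 0
    · refine ⟨_, Good_s17.univ, univ_mem, fun f _ h => ?_⟩
      have : f.1 p = x.1 p := le_antisymm h (by rw [ha]; exact zero_le)
      rw [this]; exact mem_of_mem_nhds hV
    · obtain ⟨u, hu, huV⟩ := exists_Ioc_subset_of_mem_nhds hV ⟨0, pos_iff_ne_zero.mpr ha⟩
      obtain ⟨t, ht1, ht2, ht⟩ := exists_generic μ p hu
      refine ⟨_, Good_s17.univ.gt _ p t ht, ?_, fun f hf h => huV ⟨ht1.trans (not_le.mp hf.2), h⟩⟩
      filter_upwards [(isOpen_lt continuous_const (continuous_coord p)).mem_nhds ht2] with f hf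
      exact ⟨trivial, not_le.mpr hf⟩
  obtain ⟨s, hs, hsx, hsV⟩ := h1
  obtain ⟨s', hs', hsx', hsV'⟩ := h2
  refine ⟨s ∩ s', hs.inter hs', inter_mem hsx hsx', fun f hf => ?_⟩
  rcases le_total (x.1 p) (f.1 p) with h | h
  · exact hsV f hf.1 h
  · exact hsV' f hf.2 h

lemma good_nhds {M : Type*} (μ : Measure (tildeY M)) [IsFiniteMeasure μ]
    (u : Set (tildeY M)) (hu : IsOpen u) (x : tildeY M) (hx : x ∈ u) :
    ∃ s, Good_s17 μ s ∧ s ∈ 𝓝 x ∧ s ⊆ u := by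
  classical
  obtain ⟨U, hU, rfl⟩ := isOpen_induced_iff.mp hu
  obtain ⟨I, v, hv, hIU⟩ := isOpen_pi_iff.mp hU x.1 hx
  have key : ∀ J : Finset (OffDiag M), J ⊆ I →
      ∃ s, Good_s17 μ s ∧ s ∈ 𝓝 x ∧ s ⊆ {f | ∀ i ∈ J, f.1 i ∈ v i} := by
    intro J
    induction J using Finset.induction_on with
    | empty => exact fun _ => ⟨_, Good_s17.univ, univ_mem, by simp⟩
    | insert a J _ ih =>
      intro hJ
      obtain ⟨s, h1, h2, h3⟩ := ih ((Finset.subset_insert _ _).trans hJ)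
      have hav := hv a (hJ (Finset.mem_insert_self _ _))
      obtain ⟨s', h1', h2', h3'⟩ := coord_nhds μ a x (hav.1.mem_nhds hav.2)
      refine ⟨s ∩ s', h1.inter h1', inter_mem h2 h2', fun f hf i hi => ?_⟩
      rcases Finset.mem_insert.mp hi with rfl | hi
      · exact h3' hf.2
      · exact h3 hf.1 i hi
  obtain ⟨s, h1, h2, h3⟩ := key I subset_rfl
  exact ⟨s, h1, h2, fun f hf => hIU fun i hi => h3 hf i hi⟩

/-- Weak convergence of Borel probability measures on `𝒴̃` is equivalent to
convergence of `μₙ(Q̃_Z)` for all `Z ∈ 𝒵` whose set `Q̃_Z` is a `μ`-continuity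
set. -/
theorem weak_convergence_iff {M : Type*} [Countable M] [Infinite M]
    (μs : ℕ → MeasureTheory.Measure (tildeY M)) (μ : MeasureTheory.Measure (tildeY M))
    [∀ n, MeasureTheory.IsProbabilityMeasure (μs n)]
    [MeasureTheory.IsProbabilityMeasure μ] :
    (∀ g : (tildeY M) → ℝ, Continuous g →
        Filter.Tendsto (fun n => ∫ x, g x ∂(μs n)) Filter.atTop (nhds (∫ x, g x ∂μ)))
      ↔ ∀ Z : ℝ≥0 → Set (M × M), MemZ Z → μ (frontier (Qtilde Z)) = 0 →
          Filter.Tendsto (fun n => ((μs n) (Qtilde Z)).toReal) Filter.atTop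
            (nhds ((μ (Qtilde Z)).toReal)) := by
  have hC := compactSpace_tildeY M
  let P : ℕ → ProbabilityMeasure (tildeY M) := fun n => ⟨μs n, inferInstance⟩
  let Q : ProbabilityMeasure (tildeY M) := ⟨μ, inferInstance⟩
  have hiff : (∀ g : (tildeY M) → ℝ, Continuous g →
        Filter.Tendsto (fun n => ∫ x, g x ∂(μs n)) Filter.atTop (nhds (∫ x, g x ∂μ)))
      ↔ Tendsto P atTop (𝓝 Q) := by
    rw [ProbabilityMeasure.tendsto_iff_forall_integral_tendsto]
    constructor
    · intro h f
      exact h f f.continuous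
    · intro h g hg
      exact h (BoundedContinuousFunction.mkOfCompact ⟨g, hg⟩)
  rw [hiff]
  constructor
  · intro h Z _ hZ
    exact (ENNReal.tendsto_toReal (measure_ne_top _ _)).comp
      (ProbabilityMeasure.tendsto_measure_of_null_frontier_of_tendsto' h hZ)
  · intro h
    have hr : ∀ L : List (OffDiag M × ℝ≥0), (∀ q ∈ L, μ {f | f.1 q.1 = q.2} = 0) →
        Tendsto (fun n => (μs n).real (rect L)) atTop (𝓝 (μ.real (rect L))) := by
      intro L hL
      obtain ⟨Z, hZ, hZL⟩ := exists_Z_rect L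
      have := h Z hZ (by rw [hZL]; exact frontier_rect μ L hL)
      rw [hZL] at this
      exact this
    refine IsPiSystem.tendsto_probabilityMeasure_of_tendsto_of_mem (S := {s | Good_s17 μ s})
      (fun s hs t ht _ => Good_s17.inter hs ht) (fun s hs => hs.measurable)
      (fun u hu x hx => good_nhds μ u hu x hx) (fun s hs => ?_)
    have := hs.tendsto hr [] (by simp)
    have he : rect ([] : List (OffDiag M × ℝ≥0)) = Set.univ := by ext f; simp [rect]
    rw [he, inter_univ] at this
    exact NNReal.tendsto_coe.mp this
end
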